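/- Let φ : 𝔻 → 𝔻 be a univalent (injective) analytic full self-map of the unit disk with φ(0) = p, and let α_p(z) = (p − z)/(1 − conj(p)·z). Then for every analytic f : 𝔻 → ℂ, ∫_𝔻 |(f ∘ φ)'(z)|² dA(z) = ∫_𝔻 |(f ∘ α_p)'(z)|² dA(z); consequently ‖C_φ f‖_𝒟 = ‖C_{α_p} f‖_𝒟 for every f in the Dirichlet space. -/

import Mathlib

open MeasureTheory Metric Set Complex
open scoped ENNReal

/-- The normalized area measure `dA = (1/π) dx dy` on `ℂ`. -/
noncomputable def dA : Measure ℂ := (ENNReal.ofReal Real.pi)⁻¹ • volume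

/-- The real Jacobian determinant of multiplication by `c` on `ℂ` is `‖c‖ ^ 2`. -/
lemma det_restrictScalars_toSpanSingleton (c : ℂ) :
    ((ContinuousLinearMap.toSpanSingleton ℂ c).restrictScalars ℝ).det = ‖c‖ ^ 2 := by
  simp [ContinuousLinearMap.det, LinearMap.det_restrictScalars, Algebra.norm_complex_apply,
    Complex.normSq_eq_norm_sq]

/-- Conformal change of variables: if `φ` is an injective analytic map from an open set `U` into an
open set `V` covering almost all of `V`, then `f` and `f ∘ φ` have the same Dirichlet integral. -/
lemma lintegral_deriv_comp_sq_eq {U V : Set ℂ} (hU : IsOpen U) (hV : IsOpen V) {φ f : ℂ → ℂ}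
    (hφ : DifferentiableOn ℂ φ U) (hmaps : MapsTo φ U V) (hinj : InjOn φ U)
    (hfull : volume (V \ φ '' U) = 0) (hf : DifferentiableOn ℂ f V) :
    ∫⁻ z in U, (‖deriv (f ∘ φ) z‖₊ : ℝ≥0∞) ^ 2 = ∫⁻ z in V, (‖deriv f z‖₊ : ℝ≥0∞) ^ 2 := by
  have himage : φ '' U =ᵐ[volume] V :=
    hmaps.image_subset.eventuallyLE.antisymm (ae_le_set.2 hfull)
  rw [← setLIntegral_congr himage, lintegral_image_eq_lintegral_abs_det_fderiv_mul volume
    hU.measurableSet (fun z hz => ((hφ.differentiableAt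
      (hU.mem_nhds hz)).hasDerivAt.hasFDerivAt.restrictScalars ℝ).hasFDerivWithinAt) hinj]
  refine setLIntegral_congr_fun hU.measurableSet fun z hz => ?_
  have hfz := hf.differentiableAt (hV.mem_nhds (hmaps hz))
  simp only [deriv_comp z hfz (hφ.differentiableAt (hU.mem_nhds hz)),
    det_restrictScalars_toSpanSingleton, abs_pow, abs_norm,
    ENNReal.ofReal_pow (norm_nonneg _), ofReal_norm, enorm_eq_nnnorm, nnnorm_mul,
    ENNReal.coe_mul, mul_pow]
  exact mul_comm _ _

section DiskAutomorphism

variable {p z : ℂ}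

lemma one_sub_conj_mul_ne_zero (hp : ‖p‖ < 1) (hz : ‖z‖ < 1) :
    1 - (starRingEnd ℂ) p * z ≠ 0 := by
  intro h
  have h1 : ‖(starRingEnd ℂ) p * z‖ = 1 := by rw [← sub_eq_zero.1 h, norm_one]
  rw [norm_mul, RCLike.norm_conj] at h1
  nlinarith [norm_nonneg p, norm_nonneg z]

lemma norm_sub_div_one_sub_conj_mul_lt_one (hp : ‖p‖ < 1) (hz : ‖z‖ < 1) :
    ‖(p - z) / (1 - (starRingEnd ℂ) p * z)‖ < 1 := by
  rw [norm_div, div_lt_one (norm_pos_iff.2 (one_sub_conj_mul_ne_zero hp hz))]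
  refine lt_of_pow_lt_pow_left₀ 2 (norm_nonneg _) ?_
  have hp2 : normSq p < 1 := by
    rw [normSq_eq_norm_sq]; exact pow_lt_one₀ (norm_nonneg _) hp two_ne_zero
  have hz2 : normSq z < 1 := by
    rw [normSq_eq_norm_sq]; exact pow_lt_one₀ (norm_nonneg _) hz two_ne_zero
  rw [← normSq_eq_norm_sq, ← normSq_eq_norm_sq]
  simp only [normSq_apply, sub_re, sub_im, mul_re, mul_im, conj_re, conj_im, one_re,
    one_im] at *
  nlinarith [mul_pos (sub_pos.2 hp2) (sub_pos.2 hz2)]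

lemma sub_div_one_sub_conj_mul_involutive (hp : ‖p‖ < 1) (hz : ‖z‖ < 1) :
    (p - (p - z) / (1 - (starRingEnd ℂ) p * z)) /
      (1 - (starRingEnd ℂ) p * ((p - z) / (1 - (starRingEnd ℂ) p * z))) = z := by
  have hz0 := one_sub_conj_mul_ne_zero hp hz
  rw [div_eq_iff (one_sub_conj_mul_ne_zero hp (norm_sub_div_one_sub_conj_mul_lt_one hp hz))]
  rw [sub_div' hz0, mul_div_assoc', one_sub_div hz0, mul_div_assoc']
  congr 1
  ring

end DiskAutomorphism

/-- If `φ` is a univalent analytic full self-map of `𝔻` with `φ(0) = p`, and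
`α_p(z) = (p - z)/(1 - conj(p) z)`, then for every analytic `f` on `𝔻`,
`∫_𝔻 |(f ∘ φ)'|² dA = ∫_𝔻 |(f ∘ α_p)'|² dA`; consequently `‖C_φ f‖_𝒟 = ‖C_{α_p} f‖_𝒟`
for every `f` in the Dirichlet space. -/
theorem dirichlet_integral_comp_full_eq_comp_automorphism
    (φ : ℂ → ℂ) (p : ℂ)
    (hφa : DifferentiableOn ℂ φ (ball (0:ℂ) 1))
    (hφm : MapsTo φ (ball (0:ℂ) 1) (ball (0:ℂ) 1))
    (hφu : InjOn φ (ball (0:ℂ) 1))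
    (hfull : dA (ball (0:ℂ) 1 \ φ '' ball (0:ℂ) 1) = 0)
    (hφ0 : φ 0 = p)
    (αp : ℂ → ℂ) (hαp : ∀ z, αp z = (p - z) / (1 - (starRingEnd ℂ) p * z)) :
    ∀ f : ℂ → ℂ, DifferentiableOn ℂ f (ball (0:ℂ) 1) →
      (∫⁻ z in ball (0:ℂ) 1, (‖deriv (f ∘ φ) z‖₊ : ℝ≥0∞) ^ 2 ∂dA)
        = ∫⁻ z in ball (0:ℂ) 1, (‖deriv (f ∘ αp) z‖₊ : ℝ≥0∞) ^ 2 ∂dA := by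
  intro f hf
  have hp : ‖p‖ < 1 := by
    simpa [hφ0] using hφm (mem_ball_self one_pos)
  obtain rfl : αp = fun z => (p - z) / (1 - (starRingEnd ℂ) p * z) := funext hαp
  have hmaps : MapsTo (fun z => (p - z) / (1 - (starRingEnd ℂ) p * z))
      (ball (0:ℂ) 1) (ball (0:ℂ) 1) := fun z hz =>
    mem_ball_zero_iff.2 (norm_sub_div_one_sub_conj_mul_lt_one hp (mem_ball_zero_iff.1 hz))
  have hinv : LeftInvOn (fun z => (p - z) / (1 - (starRingEnd ℂ) p * z))
      (fun z => (p - z) / (1 - (starRingEnd ℂ) p * z)) (ball (0:ℂ) 1) := fun z hz =>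
    sub_div_one_sub_conj_mul_involutive hp (mem_ball_zero_iff.1 hz)
  have hdiff : DifferentiableOn ℂ (fun z => (p - z) / (1 - (starRingEnd ℂ) p * z))
      (ball (0:ℂ) 1) :=
    DifferentiableOn.fun_div (by fun_prop) (by fun_prop) fun z hz =>
      one_sub_conj_mul_ne_zero hp (mem_ball_zero_iff.1 hz)
  have hsurj := hinv.surjOn hmaps
  have hvol : volume (ball (0:ℂ) 1 \ φ '' ball (0:ℂ) 1) = 0 := by
    simpa [dA] using hfull
  simp only [dA, Measure.restrict_smul, lintegral_smul_measure]
  rw [lintegral_deriv_comp_sq_eq isOpen_ball isOpen_ball hφa hφm hφu hvol hf,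
    lintegral_deriv_comp_sq_eq isOpen_ball isOpen_ball hdiff hmaps hinv.injOn
      (by rw [sdiff_eq_empty.2 hsurj, measure_empty]) hf]
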